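/- There is an algorithm that, given an integer k ≥ 2, a DFAO M generating a k-automatic sequence a = (a_n)_{n≥0}, and a rational number r > 1, decides whether a avoids x^r for all sufficiently long x, i.e., whether there exists a length l such that no factor of a is an r-power x^r with |x| ≥ l. -/

import Mathlib

/-- Run an encoded DFAO transition table from state `q` on a list of base-`k`
digits, least significant digit first (this is `w^R` for a most-significant-first
representation `w`). -/
def dfaoRun (trans : List (List ℕ)) : ℕ → List ℕ → ℕ
  | q, [] => q
  | q, d :: ds => dfaoRun trans ((trans.getD q []).getD d 0) ds

/-- The encoded DFAO `(trans, q0, out)` over input alphabet `Σ_k = {0,…,k-1}`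
generates the sequence `a`: for every `m` and every base-`k` representation `w`
of `m` (given least significant digit first, possibly with trailing zeros,
all digits `< k`), the output on `w` is `a m`. -/
def dfaoGenerates (k : ℕ) (trans : List (List ℕ)) (q0 : ℕ) (out : List ℕ)
    (a : ℕ → ℕ) : Prop :=
  ∀ (m : ℕ) (w : List ℕ), (∀ d ∈ w, d < k) → Nat.ofDigits k w = m →
    a m = out.getD (dfaoRun trans q0 w) 0

/-- The factor `a_i a_{i+1} ⋯ a_{i+L-1}` of the sequence `a`. -/
def factorAt (a : ℕ → ℕ) (i L : ℕ) : List ℕ :=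
  (List.range L).map fun j => a (i + j)

/-- `w` is a factor of the infinite word `a`. -/
def IsFactorOf (a : ℕ → ℕ) (w : List ℕ) : Prop :=
  ∃ i : ℕ, w = factorAt a i w.length

/-- `z` is an `r`-power `x^r` for `r = p/q` built from a word `x` of length `T`:
`z` is the shortest prefix of `x^ω` of length `≥ (p/q)·T`, i.e. `z` has length
`⌈(p/q)·T⌉`, has period `T`, and `x` is its prefix of length `T`. -/
def IsRPowerOf (p q T : ℕ) (z : List ℕ) : Prop :=
  1 ≤ T ∧ T ≤ z.length ∧
    (∀ j : ℕ, j + T < z.length → z.getD j 0 = z.getD (j + T) 0) ∧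
    p * T ≤ q * z.length ∧ q * (z.length - 1) < p * T

/-- `z` is an `r⁺`-power for `r = p/q` built from a word `x` of length `T`:
`z` is the shortest prefix of `x^ω` of length `> (p/q)·T`. -/
def IsRPlusPowerOf (p q T : ℕ) (z : List ℕ) : Prop :=
  1 ≤ T ∧ T ≤ z.length ∧
    (∀ j : ℕ, j + T < z.length → z.getD j 0 = z.getD (j + T) 0) ∧
    p * T < q * z.length ∧ q * (z.length - 1) ≤ p * T

/-- `z` is an `r`-power for `r = p/q`. -/
def IsRPower (p q : ℕ) (z : List ℕ) : Prop :=
  ∃ T : ℕ, IsRPowerOf p q T z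

/-- `z` is an `r⁺`-power for `r = p/q`. -/
def IsRPlusPower (p q : ℕ) (z : List ℕ) : Prop :=
  ∃ T : ℕ, IsRPlusPowerOf p q T z

/-- One step of the automaton on a pair (state, number still to be read): the least significant
digit is consumed. -/
def dfaoStep (k : ℕ) (trans : List (List ℕ)) (s : ℕ × ℕ) : ℕ × ℕ :=
  ((trans.getD s.1 []).getD (s.2 % k) 0, s.2 / k)

/-- The state reached from `q0` after reading the `m` least significant digits of `n`. -/
def dfaoState (k : ℕ) (trans : List (List ℕ)) (q0 m n : ℕ) : ℕ :=
  ((dfaoStep k trans)^[m] (q0, n)).1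

/-- The `m` least significant base-`k` digits of `n`. -/
def lowDigits (k : ℕ) : ℕ → ℕ → List ℕ
  | 0, _ => []
  | m + 1, n => n % k :: lowDigits k m (n / k)

theorem lt_of_mem_lowDigits {k : ℕ} (hk : 0 < k) :
    ∀ (m n : ℕ), ∀ d ∈ lowDigits k m n, d < k
  | 0, n => by simp [lowDigits]
  | m + 1, n => by
    intro d hd
    rcases List.mem_cons.1 hd with rfl | hd
    · exact Nat.mod_lt _ hk
    · exact lt_of_mem_lowDigits hk m _ d hd

theorem ofDigits_lowDigits (k : ℕ) :
    ∀ m n : ℕ, Nat.ofDigits k (lowDigits k m n) = n % k ^ m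
  | 0, n => by simp [lowDigits, Nat.mod_one]
  | m + 1, n => by
    rw [lowDigits, Nat.ofDigits_cons, ofDigits_lowDigits k m, pow_succ', Nat.mod_mul]

theorem iterate_dfaoStep_fst (k : ℕ) (trans : List (List ℕ)) :
    ∀ m q n : ℕ, ((dfaoStep k trans)^[m] (q, n)).1 = dfaoRun trans q (lowDigits k m n)
  | 0, q, n => rfl
  | m + 1, q, n => by
    rw [Function.iterate_succ_apply, dfaoStep, iterate_dfaoStep_fst k trans m]
    rfl

theorem iterate_dfaoStep_snd (k : ℕ) (trans : List (List ℕ)) :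
    ∀ m q n : ℕ, ((dfaoStep k trans)^[m] (q, n)).2 = n / k ^ m
  | 0, q, n => by simp
  | m + 1, q, n => by
    rw [Function.iterate_succ_apply, dfaoStep, iterate_dfaoStep_snd k trans m,
      Nat.div_div_eq_div_mul, pow_succ']

theorem lowDigits_mod (k : ℕ) : ∀ m n : ℕ, lowDigits k m (n % k ^ m) = lowDigits k m n
  | 0, n => rfl
  | m + 1, n => by
    rw [lowDigits, lowDigits, pow_succ', Nat.mod_mul_right_mod, Nat.mod_mul_right_div_self,
      lowDigits_mod k m]

theorem iterate_dfaoStep_mul_add {k : ℕ} (hk : 0 < k) (trans : List (List ℕ)) (q0 m z s : ℕ) :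
    (dfaoStep k trans)^[m] (q0, k ^ m * z + s) = (dfaoState k trans q0 m s, z + s / k ^ m) := by
  refine Prod.ext ?_ ?_
  · rw [dfaoState, iterate_dfaoStep_fst, iterate_dfaoStep_fst, ← lowDigits_mod,
      Nat.mul_add_mod, lowDigits_mod]
  · rw [iterate_dfaoStep_snd, Nat.mul_add_div (pow_pos hk m)]

/-- The finite set of states reachable from `q0`. -/
def dfaoStates (trans : List (List ℕ)) (q0 : ℕ) : Finset ℕ :=
  (q0 :: 0 :: trans.flatten).toFinset

theorem List.getD_mem_cons {α : Type*} (l : List α) (n : ℕ) (d : α) : l.getD n d ∈ d :: l := by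
  rw [List.getD_eq_getElem?_getD]
  rcases h : l[n]? with _ | x
  · simp
  · exact List.mem_cons_of_mem _ (List.mem_of_getElem? h)

theorem dfaoState_mem (k : ℕ) (trans : List (List ℕ)) (q0 m n : ℕ) :
    dfaoState k trans q0 m n ∈ dfaoStates trans q0 := by
  rcases m with _ | m
  · simp [dfaoState, dfaoStates]
  · rw [dfaoState, Function.iterate_succ_apply', dfaoStep, dfaoStates, List.mem_toFinset]
    refine List.mem_cons_of_mem _ ?_
    set s := (dfaoStep k trans)^[m] (q0, n)
    rcases List.mem_cons.1 (List.getD_mem_cons (trans.getD s.1 []) (s.2 % k) 0) with h | h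
    · rw [h]
      exact List.mem_cons_self
    · rcases List.mem_cons.1 (List.getD_mem_cons trans s.1 []) with h' | h'
      · rw [h'] at h
        simp at h
      · exact List.mem_cons_of_mem _ (List.mem_flatten.2 ⟨_, h', h⟩)

theorem card_dfaoStates_le (trans : List (List ℕ)) (q0 : ℕ) :
    (dfaoStates trans q0).card ≤ trans.flatten.length + 2 :=
  (List.toFinset_card_le _).trans (by simp)

theorem dfaoGenerates.eq_getD {k : ℕ} {trans : List (List ℕ)} {q0 : ℕ} {out : List ℕ}
    {a : ℕ → ℕ} (h : dfaoGenerates k trans q0 out a) (hk : 2 ≤ k) {m n : ℕ} (hn : n < k ^ m) :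
    a n = out.getD (dfaoState k trans q0 m n) 0 := by
  rw [dfaoState, iterate_dfaoStep_fst]
  refine h n _ (lt_of_mem_lowDigits (by lia) m n) ?_
  rw [ofDigits_lowDigits, Nat.mod_eq_of_lt hn]

theorem dfaoGenerates.eq_of_iterate_eq {k : ℕ} {trans : List (List ℕ)} {q0 : ℕ} {out : List ℕ}
    {a : ℕ → ℕ} (h : dfaoGenerates k trans q0 out a) (hk : 2 ≤ k) {m m' n n' : ℕ}
    (he : (dfaoStep k trans)^[m] (q0, n) = (dfaoStep k trans)^[m'] (q0, n')) : a n = a n' := by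
  have hlt : ∀ u v w : ℕ, u < k ^ (u + v + w) := fun u v w =>
    (Nat.lt_pow_self (by lia)).trans_le (Nat.pow_le_pow_right (by lia) (by lia))
  rw [h.eq_getD hk (m := n + n' + m) (hlt n n' m),
    h.eq_getD hk (m := n + n' + m') (by rw [add_comm n]; exact hlt n' n m'),
    dfaoState, dfaoState, Function.iterate_add_apply _ _ m, Function.iterate_add_apply _ _ m', he]

/-- The factor of `a` of length `⌈(p/q)·T⌉` at position `i` has period `T`. -/
def HasRPowerAt (a : ℕ → ℕ) (p q i T : ℕ) : Prop :=
  ∀ j, q * (j + T) < p * T → a (i + j) = a (i + j + T)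

theorem factorAt_length (a : ℕ → ℕ) (i L : ℕ) : (factorAt a i L).length = L := by
  simp [factorAt]

theorem factorAt_getD (a : ℕ → ℕ) {i L j : ℕ} (hj : j < L) :
    (factorAt a i L).getD j 0 = a (i + j) := by
  simp [factorAt, List.getD_eq_getElem?_getD, hj]

theorem exists_isRPowerOf_iff {a : ℕ → ℕ} {p q T : ℕ} (hq : 1 ≤ q) (hpq : q < p) (hT : 1 ≤ T) :
    (∃ w, IsFactorOf a w ∧ IsRPowerOf p q T w) ↔ ∃ i, HasRPowerAt a p q i T := by
  constructor
  · rintro ⟨w, ⟨i, hw⟩, -, -, hper, hle, -⟩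
    refine ⟨i, fun j hj => ?_⟩
    have hjL : j + T < w.length := by
      by_contra! hlt
      have := Nat.mul_le_mul_left q hlt
      lia
    have := hper j hjL
    rw [hw, factorAt_getD a (by lia), factorAt_getD a hjL] at this
    rw [this, add_assoc]
  · rintro ⟨i, hi⟩
    have hdm := Nat.div_add_mod (p * T + q - 1) q
    have hml := Nat.mod_lt (p * T + q - 1) (show q > 0 by lia)
    set L := (p * T + q - 1) / q
    have hle : p * T ≤ q * L := by lia
    have hqT : q * T < p * T := Nat.mul_lt_mul_of_pos_right hpq hT
    have hTL : T ≤ L := by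
      by_contra! hlt
      have := Nat.mul_le_mul_left q hlt.le
      lia
    have hlt : q * (L - 1) < p * T := by
      rw [Nat.mul_sub_one]
      lia
    refine ⟨factorAt a i L, ⟨i, by rw [factorAt_length]⟩, hT, ?_, ?_, ?_, ?_⟩ <;>
      rw [factorAt_length]
    · exact hTL
    · intro j hj
      rw [factorAt_getD a (by lia), factorAt_getD a hj, hi j, add_assoc]
      exact (Nat.mul_le_mul_left q (by lia)).trans_lt hlt
    · exact hle
    · exact hlt

/-- What `HasRPowerAt` at numbers with low digits `b`, `c` needs to know about an offset with low
digits `d`: the states reached at the two compared positions, the carries into their high digits,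
and the threshold for the comparison of lengths. -/
def offsetType (k : ℕ) (trans : List (List ℕ)) (q0 p q m b c d : ℕ) : ℕ × ℕ × ℕ × ℕ × ℕ :=
  (dfaoState k trans q0 m (b + d), (b + d) / k ^ m,
    dfaoState k trans q0 m (b + d + c), (b + d + c) / k ^ m,
    (q * (d + c) + p * (k ^ m - c)) / k ^ m)

/-- The set of offset types occurring for the low digits `b`, `c`. -/
def offsetTypes (k : ℕ) (trans : List (List ℕ)) (q0 p q m b c : ℕ) :
    Finset (ℕ × ℕ × ℕ × ℕ × ℕ) :=
  (Finset.range (k ^ m)).image (offsetType k trans q0 p q m b c)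

/-- A finite set containing all offset types. -/
def allOffsetTypes (trans : List (List ℕ)) (q0 p q : ℕ) : Finset (ℕ × ℕ × ℕ × ℕ × ℕ) :=
  dfaoStates trans q0 ×ˢ Finset.range 2 ×ˢ dfaoStates trans q0 ×ˢ Finset.range 3 ×ˢ
    Finset.range (2 * q + p)

theorem offsetTypes_subset {k : ℕ} (hk : 0 < k) (trans : List (List ℕ)) (q0 : ℕ) (p : ℕ) {q : ℕ}
    (hq : 1 ≤ q) {m b c : ℕ} (hb : b < k ^ m) (hc : c < k ^ m) :
    offsetTypes k trans q0 p q m b c ⊆ allOffsetTypes trans q0 p q := by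
  intro t ht
  obtain ⟨d, hd, rfl⟩ := Finset.mem_image.1 ht
  rw [Finset.mem_range] at hd
  have hK : 0 < k ^ m := pow_pos hk m
  simp only [allOffsetTypes, offsetType, Finset.mem_product, Finset.mem_range, dfaoState_mem,
    true_and, Nat.div_lt_iff_lt_mul hK]
  refine ⟨by lia, by lia, ?_⟩
  have h₁ : q * (d + c) < q * (2 * k ^ m) := Nat.mul_lt_mul_of_pos_left (by lia) hq
  have h₂ : p * (k ^ m - c) ≤ p * k ^ m := Nat.mul_le_mul_left p (Nat.sub_le _ _)
  linarith

/-- An upper bound for the number of sets of offset types. -/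
def pumpingBound (trans : List (List ℕ)) (p q : ℕ) : ℕ :=
  2 ^ ((trans.flatten.length + 2) * (2 * ((trans.flatten.length + 2) * (3 * (2 * q + p)))))

theorem card_powerset_allOffsetTypes_le (trans : List (List ℕ)) (q0 p q : ℕ) :
    (allOffsetTypes trans q0 p q).powerset.card ≤ pumpingBound trans p q := by
  rw [Finset.card_powerset, pumpingBound]
  refine Nat.pow_le_pow_right two_pos ?_
  simp only [allOffsetTypes, Finset.card_product, Finset.card_range]
  have := card_dfaoStates_le trans q0
  gcongr

theorem length_lt_iff {K : ℕ} (hK : 0 < K) (p q : ℕ) {c : ℕ} (hc : c < K) (j y d : ℕ) :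
    q * (K * j + d + (K * y + c)) < p * (K * y + c) ↔
      q * (j + y) + (q * (d + c) + p * (K - c)) / K < p * (y + 1) := by
  rw [← Nat.mul_add_div hK, Nat.div_lt_iff_lt_mul hK]
  obtain ⟨e, rfl⟩ := Nat.exists_eq_add_of_lt hc
  have : c + e + 1 - c = e + 1 := by lia
  rw [this]
  constructor <;> intro h <;> nlinarith

theorem HasRPowerAt.of_offsetTypes_eq {k : ℕ} {trans : List (List ℕ)} {q0 : ℕ} {out : List ℕ}
    {a : ℕ → ℕ} (hgen : dfaoGenerates k trans q0 out a) (hk : 2 ≤ k) {p q m m' b b' c c' : ℕ}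
    (hc : c < k ^ m) (hc' : c' < k ^ m')
    (he : offsetTypes k trans q0 p q m b c = offsetTypes k trans q0 p q m' b' c') {x y : ℕ}
    (hS : HasRPowerAt a p q (k ^ m * x + b) (k ^ m * y + c)) :
    HasRPowerAt a p q (k ^ m' * x + b') (k ^ m' * y + c') := by
  intro j hj
  have hk0 : 0 < k := by lia
  have hK : 0 < k ^ m := pow_pos hk0 m
  have hK' : 0 < k ^ m' := pow_pos hk0 m'
  obtain ⟨z, d', hd', rfl⟩ : ∃ z d', d' < k ^ m' ∧ j = k ^ m' * z + d' :=
    ⟨j / k ^ m', j % k ^ m', Nat.mod_lt _ hK', (Nat.div_add_mod _ _).symm⟩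
  have hmem : offsetType k trans q0 p q m' b' c' d' ∈ offsetTypes k trans q0 p q m b c := by
    rw [he]
    exact Finset.mem_image_of_mem _ (Finset.mem_range.2 hd')
  obtain ⟨d, -, hd⟩ := Finset.mem_image.1 hmem
  simp only [offsetType, Prod.mk.injEq] at hd
  obtain ⟨h₁, h₂, h₃, h₄, h₅⟩ := hd
  rw [length_lt_iff hK' p q hc', ← h₅, ← length_lt_iff hK p q hc] at hj
  have key := hS _ hj
  have e₁ : a (k ^ m * x + b + (k ^ m * z + d)) = a (k ^ m' * x + b' + (k ^ m' * z + d')) := by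
    refine hgen.eq_of_iterate_eq hk (m := m) (m' := m') ?_
    have r : ∀ K u v : ℕ, K * x + u + (K * z + v) = K * (x + z) + (u + v) := by intros; ring
    rw [r, r, iterate_dfaoStep_mul_add hk0, iterate_dfaoStep_mul_add hk0, h₁, h₂]
  have e₂ : a (k ^ m * x + b + (k ^ m * z + d) + (k ^ m * y + c)) =
      a (k ^ m' * x + b' + (k ^ m' * z + d') + (k ^ m' * y + c')) := by
    refine hgen.eq_of_iterate_eq hk (m := m) (m' := m') ?_
    have r : ∀ K u v w : ℕ, K * x + u + (K * z + v) + (K * y + w) =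
      K * (x + z + y) + (u + v + w) := by intros; ring
    rw [r, r, iterate_dfaoStep_mul_add hk0, iterate_dfaoStep_mul_add hk0, h₃, h₄]
  rw [← e₁, ← e₂, key]

/-- Among any `N + 1` consecutive digit positions of a pair `(i, T)`, two can be found such that
the low digits up to these positions are interchangeable for membership in `S`. -/
def IsPumpable (k N : ℕ) (S : ℕ → ℕ → Prop) : Prop :=
  ∀ i T m₀ : ℕ, ∃ m m', m₀ ≤ m ∧ m < m' ∧ m' ≤ m₀ + N ∧ ∀ x y,
    S (k ^ m * x + i % k ^ m) (k ^ m * y + T % k ^ m) ↔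
      S (k ^ m' * x + i % k ^ m') (k ^ m' * y + T % k ^ m')

theorem isPumpable_hasRPowerAt {k : ℕ} {trans : List (List ℕ)} {q0 : ℕ} {out : List ℕ}
    {a : ℕ → ℕ} (hgen : dfaoGenerates k trans q0 out a) (hk : 2 ≤ k) (p : ℕ) {q : ℕ}
    (hq : 1 ≤ q) : IsPumpable k (pumpingBound trans p q) (HasRPowerAt a p q) := by
  intro i T m₀
  set N := pumpingBound trans p q
  have hmod : ∀ n m : ℕ, n % k ^ m < k ^ m := fun n m => Nat.mod_lt _ (pow_pos (by lia) m)
  let F : ℕ → Finset (ℕ × ℕ × ℕ × ℕ × ℕ) := fun m =>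
    offsetTypes k trans q0 p q m (i % k ^ m) (T % k ^ m)
  have hcard : (allOffsetTypes trans q0 p q).powerset.card < (Finset.Icc m₀ (m₀ + N)).card := by
    have := card_powerset_allOffsetTypes_le trans q0 p q
    rw [Nat.card_Icc]
    lia
  have hiff : ∀ {m m'}, F m = F m' → ∀ x y,
      HasRPowerAt a p q (k ^ m * x + i % k ^ m) (k ^ m * y + T % k ^ m) ↔
        HasRPowerAt a p q (k ^ m' * x + i % k ^ m') (k ^ m' * y + T % k ^ m') := fun he x y =>
    ⟨.of_offsetTypes_eq hgen hk (hmod _ _) (hmod _ _) he,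
      .of_offsetTypes_eq hgen hk (hmod _ _) (hmod _ _) he.symm⟩
  obtain ⟨m, hm, m', hm', hne, he⟩ := Finset.exists_ne_map_eq_of_card_lt_of_maps_to hcard
    (f := F) fun m _ => Finset.mem_powerset.2
      (offsetTypes_subset (by lia) trans q0 p hq (hmod _ _) (hmod _ _))
  rw [Finset.mem_Icc] at hm hm'
  rcases hne.lt_or_gt with hlt | hlt
  · exact ⟨m, m', hm.1, hlt, hm'.2, hiff he⟩
  · exact ⟨m', m, hm'.1, hlt, hm.2, hiff he.symm⟩

section Pumping

variable {k N : ℕ} {S : ℕ → ℕ → Prop}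

theorem pow_mul_div_add_mod_gt (hk : 2 ≤ k) {m m' n : ℕ} (hm : m < m') (hn : k ^ m ≤ n) :
    n < k ^ m' * (n / k ^ m) + n % k ^ m' := by
  have hK : 0 < k ^ m := pow_pos (by lia) m
  have h₁ : 0 < n / k ^ m := Nat.div_pos hn hK
  have h₂ : 2 * k ^ m ≤ k ^ m' := calc
    2 * k ^ m ≤ k * k ^ m := Nat.mul_le_mul_right _ hk
    _ = k ^ (m + 1) := (pow_succ' k m).symm
    _ ≤ k ^ m' := Nat.pow_le_pow_right (by lia) hm
  have h₃ := Nat.div_add_mod n (k ^ m)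
  have h₄ := Nat.mod_lt n hK
  have h₅ := Nat.mul_le_mul_right (n / k ^ m) h₂
  have h₆ := Nat.le_mul_of_pos_right (k ^ m) h₁
  lia

theorem pow_mul_div_add_mod_le (hk : 2 ≤ k) {m m' : ℕ} (hm : m < m') (n : ℕ) :
    k ^ m * (n / k ^ m') + n % k ^ m ≤ n := by
  have h₁ : n / k ^ m' ≤ n / k ^ m :=
    Nat.div_le_div_left (Nat.pow_le_pow_right (by lia) hm.le) (pow_pos (by lia) m)
  have h₂ := Nat.div_add_mod n (k ^ m)
  have h₃ := Nat.mul_le_mul_left (k ^ m) h₁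
  lia

theorem pow_mul_div_add_mod_lt (hk : 2 ≤ k) {m m' n : ℕ} (hm : m < m') (hn : k ^ m' ≤ n) :
    k ^ m * (n / k ^ m') + n % k ^ m < n := by
  have h₁ : 0 < n / k ^ m' := Nat.div_pos hn (pow_pos (by lia) m')
  have h₂ : n % k ^ m ≤ n % k ^ m' := by
    rw [← Nat.mod_mod_of_dvd n (pow_dvd_pow k hm.le)]
    exact Nat.mod_le _ _
  have h₃ := Nat.div_add_mod n (k ^ m')
  have h₄ : k ^ m * (n / k ^ m') < k ^ m' * (n / k ^ m') :=
    Nat.mul_lt_mul_of_pos_right (Nat.pow_lt_pow_right (by lia) hm) h₁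
  lia

theorem IsPumpable.exists_ge (hS : IsPumpable k N S) (hk : 2 ≤ k)
    (h : ∃ T i, k ^ N ≤ T ∧ S i T) (l : ℕ) : ∃ T i, l ≤ T ∧ k ^ N ≤ T ∧ S i T := by
  induction l with
  | zero =>
    obtain ⟨T, i, h⟩ := h
    exact ⟨T, i, Nat.zero_le _, h⟩
  | succ l ih =>
    obtain ⟨T, i, hl, hT, hi⟩ := ih
    obtain ⟨m, m', -, hm, hm', hiff⟩ := hS i T 0
    have hgt := pow_mul_div_add_mod_gt hk hm
      ((Nat.pow_le_pow_right (by lia) (by lia) : k ^ m ≤ k ^ N).trans hT)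
    refine ⟨_, _, ?_, hT.trans hgt.le, (hiff (i / k ^ m) (T / k ^ m)).1 ?_⟩
    · lia
    · rwa [Nat.div_add_mod, Nat.div_add_mod]

theorem IsPumpable.exists_lt (hS : IsPumpable k N S) (hk : 2 ≤ k)
    (h : ∃ T i, k ^ N ≤ T ∧ S i T) :
    ∃ T < k ^ (2 * N), ∃ i < k ^ (3 * N), k ^ N ≤ T ∧ S i T := by
  obtain ⟨T, i, hT, hi⟩ := h
  induction hn : T + i using Nat.strong_induction_on generalizing T i with
  | _ n ih =>
    subst hn
    have hmono : ∀ {u v}, u ≤ v → k ^ u ≤ k ^ v := fun h => Nat.pow_le_pow_right (by lia) h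
    rcases le_or_gt (k ^ (2 * N)) T with hT2 | hT2
    · obtain ⟨m, m', hm₀, hm, hm', hiff⟩ := hS i T N
      have hle : k ^ m' ≤ T := (hmono (by lia)).trans hT2
      have hltT := pow_mul_div_add_mod_lt hk hm hle
      have hlei := pow_mul_div_add_mod_le hk hm i
      refine ih _ ?_ _ _ ?_ ((hiff (i / k ^ m') (T / k ^ m')).2 ?_) rfl
      · lia
      · calc k ^ N ≤ k ^ m := hmono hm₀
          _ ≤ k ^ m * (T / k ^ m') :=
            Nat.le_mul_of_pos_right _ (Nat.div_pos hle (pow_pos (by lia) m'))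
          _ ≤ _ := Nat.le_add_right _ _
      · rwa [Nat.div_add_mod, Nat.div_add_mod]
    rcases le_or_gt (k ^ (3 * N)) i with hi3 | hi3
    · obtain ⟨m, m', hm₀, hm, hm', hiff⟩ := hS i T (2 * N)
      have hlti := pow_mul_div_add_mod_lt hk hm ((hmono (by lia)).trans hi3)
      have hTm : T < k ^ m := hT2.trans_le (hmono hm₀)
      have hT' : k ^ m * (T / k ^ m') + T % k ^ m = T := by
        rw [Nat.div_eq_of_lt (hTm.trans_le (hmono hm.le)), Nat.mod_eq_of_lt hTm, mul_zero,
          zero_add]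
      have hS' := (hiff (i / k ^ m') (T / k ^ m')).2
        (by rwa [Nat.div_add_mod, Nat.div_add_mod])
      rw [hT'] at hS'
      exact ih _ (by lia) _ _ hT hS' rfl
    · exact ⟨T, hT2, i, hi3, hT, hi⟩

end Pumping

/-- The sequence generated by a DFAO. -/
def dfaoValue (k : ℕ) (trans : List (List ℕ)) (q0 : ℕ) (out : List ℕ) (n : ℕ) : ℕ :=
  out.getD (dfaoState k trans q0 n n) 0

/-- The type of encoded inputs `(k, trans, q0, out, p, q)`. -/
abbrev DFAOInput : Type := ℕ × List (List ℕ) × ℕ × List ℕ × ℕ × ℕ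

/-- The sequence generated by the DFAO of an input. -/
def DFAOInput.value (s : DFAOInput) (n : ℕ) : ℕ :=
  dfaoValue s.1 s.2.1 s.2.2.1 s.2.2.2.1 n

/-- The pumping bound of an input. -/
def DFAOInput.bound (s : DFAOInput) : ℕ :=
  pumpingBound s.2.1 s.2.2.2.2.1 s.2.2.2.2.2

/-- Bounded search for an `r`-power whose root is at least as long as the pumping threshold. -/
def DFAOInput.HasLongRPower (s : DFAOInput) : Prop :=
  ∃ T < s.1 ^ (2 * s.bound), ∃ i < s.1 ^ (3 * s.bound), s.1 ^ s.bound ≤ T ∧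
    ∀ j < s.2.2.2.2.1 * T, s.2.2.2.2.2 * (j + T) < s.2.2.2.2.1 * T →
      s.value (i + j) = s.value (i + j + T)

theorem DFAOInput.hasLongRPower_iff {k : ℕ} {trans : List (List ℕ)} {q0 : ℕ} {out : List ℕ}
    {a : ℕ → ℕ} {p q : ℕ} (hk : 2 ≤ k) (hgen : dfaoGenerates k trans q0 out a) (hq : 1 ≤ q) :
    HasLongRPower (k, trans, q0, out, p, q) ↔
      ∀ l, ∃ T i, l ≤ T ∧ HasRPowerAt a p q i T := by
  have hval : value (k, trans, q0, out, p, q) = a := funext fun n =>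
    (hgen.eq_getD hk (Nat.lt_pow_self (by lia))).symm
  have hpump := isPumpable_hasRPowerAt hgen hk p hq
  have hforall : ∀ i T, (∀ j < p * T, q * (j + T) < p * T → a (i + j) = a (i + j + T)) ↔
      HasRPowerAt a p q i T := fun i T =>
    ⟨fun h j hj => h j (by nlinarith) hj, fun h j _ hj => h j hj⟩
  simp only [HasLongRPower, hval, hforall, bound]
  constructor
  · rintro ⟨T, -, i, -, hT, hi⟩ l
    obtain ⟨T', i', hl, -, hi'⟩ := hpump.exists_ge hk ⟨T, i, hT, hi⟩ l
    exact ⟨T', i', hl, hi'⟩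
  · intro h
    obtain ⟨T, i, hT, hi⟩ := h (k ^ pumpingBound trans p q)
    exact hpump.exists_lt hk ⟨T, i, hT, hi⟩

section Computability

open Primrec

variable {α : Type*} [Primcodable α]

theorem Primrec.nat_pow : Primrec₂ ((· ^ ·) : ℕ → ℕ → ℕ) :=
  Primrec₂.unpaired'.1 Nat.Primrec.pow

theorem PrimrecPred.imp {P Q : α → Prop} (hP : PrimrecPred P) (hQ : PrimrecPred Q) :
    PrimrecPred fun x => P x → Q x :=
  (hP.not.or hQ).of_eq fun _ => imp_iff_not_or.symm

theorem PrimrecRel.forall_lt_comp {R : ℕ → α → Prop} (hR : PrimrecRel R) {f : α → ℕ}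
    (hf : Primrec f) : PrimrecPred fun x => ∀ j < f x, R j x :=
  (hR.forall_mem_list.comp (list_range.comp hf) Primrec.id).of_eq fun _ => by simp

theorem PrimrecRel.exists_lt_comp {R : ℕ → α → Prop} (hR : PrimrecRel R) {f : α → ℕ}
    (hf : Primrec f) : PrimrecPred fun x => ∃ j < f x, R j x :=
  (hR.exists_mem_list.comp (list_range.comp hf) Primrec.id).of_eq fun _ => by simp

theorem DFAOInput.primrec_value : Primrec₂ DFAOInput.value := by
  have hstep : Primrec₂ fun (x : DFAOInput × ℕ) (s : ℕ × ℕ) => dfaoStep x.1.1 x.1.2.1 s := by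
    have hk : Primrec fun y : (DFAOInput × ℕ) × ℕ × ℕ => y.1.1.1 := fst.comp (fst.comp fst)
    have htrans : Primrec fun y : (DFAOInput × ℕ) × ℕ × ℕ => y.1.1.2.1 :=
      fst.comp (snd.comp (fst.comp fst))
    have hn : Primrec fun y : (DFAOInput × ℕ) × ℕ × ℕ => y.2.2 := snd.comp snd
    exact Primrec.pair ((list_getD 0).comp ((list_getD []).comp htrans (fst.comp snd))
      (nat_mod.comp hn hk)) (nat_div.comp hn hk)
  have hq0 : Primrec fun x : DFAOInput × ℕ => x.1.2.2.1 :=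
    fst.comp (snd.comp (snd.comp fst))
  have hout : Primrec fun x : DFAOInput × ℕ => x.1.2.2.2.1 :=
    fst.comp (snd.comp (snd.comp (snd.comp fst)))
  exact (list_getD 0).comp hout (fst.comp (nat_iterate snd (hq0.pair snd) hstep))

theorem DFAOInput.primrec_p : Primrec fun s : DFAOInput => s.2.2.2.2.1 :=
  fst.comp (snd.comp (snd.comp (snd.comp snd)))

theorem DFAOInput.primrec_q : Primrec fun s : DFAOInput => s.2.2.2.2.2 :=
  snd.comp (snd.comp (snd.comp (snd.comp snd)))

theorem DFAOInput.primrec_bound : Primrec DFAOInput.bound := by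
  have hlen : Primrec fun s : DFAOInput => s.2.1.flatten.length + 2 :=
    nat_add.comp (list_length.comp (list_flatten.comp (fst.comp snd))) (.const 2)
  exact nat_pow.comp (.const 2) (nat_mul.comp hlen (nat_mul.comp (.const 2) (nat_mul.comp hlen
    (nat_mul.comp (.const 3) (nat_add.comp (nat_mul.comp (.const 2) primrec_q) primrec_p)))))

theorem DFAOInput.primrecPred_hasLongRPower : PrimrecPred DFAOInput.HasLongRPower := by
  have hpow : ∀ c, Primrec fun s : DFAOInput => s.1 ^ (c * s.bound) := fun c =>
    nat_pow.comp fst (nat_mul.comp (.const c) primrec_bound)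
  refine PrimrecRel.exists_lt_comp
    (R := fun T (s : DFAOInput) => ∃ i < s.1 ^ (3 * s.bound), s.1 ^ s.bound ≤ T ∧
      ∀ j < s.2.2.2.2.1 * T, s.2.2.2.2.2 * (j + T) < s.2.2.2.2.1 * T →
        s.value (i + j) = s.value (i + j + T)) ?_ (hpow 2)
  refine PrimrecRel.exists_lt_comp
    (R := fun i (x : ℕ × DFAOInput) => x.2.1 ^ x.2.bound ≤ x.1 ∧
      ∀ j < x.2.2.2.2.2.1 * x.1, x.2.2.2.2.2.2 * (j + x.1) < x.2.2.2.2.2.1 * x.1 →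
        x.2.value (i + j) = x.2.value (i + j + x.1)) ?_ ((hpow 3).comp snd)
  refine PrimrecPred.and (nat_le.comp (nat_pow.comp (fst.comp (snd.comp snd))
    (primrec_bound.comp (snd.comp snd))) (fst.comp snd)) ?_
  refine PrimrecRel.forall_lt_comp
    (R := fun j (y : ℕ × ℕ × DFAOInput) =>
      y.2.2.2.2.2.2.2 * (j + y.2.1) < y.2.2.2.2.2.2.1 * y.2.1 →
        y.2.2.value (y.1 + j) = y.2.2.value (y.1 + j + y.2.1)) ?_
    (nat_mul.comp (primrec_p.comp (snd.comp snd)) (fst.comp snd))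
  have hT : Primrec fun z : ℕ × ℕ × ℕ × DFAOInput => z.2.2.1 := fst.comp (snd.comp snd)
  have hs : Primrec fun z : ℕ × ℕ × ℕ × DFAOInput => z.2.2.2 := snd.comp (snd.comp snd)
  have hij : Primrec fun z : ℕ × ℕ × ℕ × DFAOInput => z.2.1 + z.1 :=
    nat_add.comp (fst.comp snd) fst
  exact PrimrecPred.imp
    (nat_lt.comp (nat_mul.comp (primrec_q.comp hs) (nat_add.comp fst hT))
      (nat_mul.comp (primrec_p.comp hs) hT))
    (Primrec.eq.comp (primrec_value.comp hs hij) (primrec_value.comp hs (nat_add.comp hij hT)))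

end Computability

/-- It is decidable, given `k ≥ 2`, a DFAO generating a `k`-automatic sequence
`a`, and a rational `r = p/q > 1`, whether `a` avoids `x^r` for all
sufficiently long `x`, i.e. whether there is a length `l` such that no factor
of `a` is an `r`-power `x^r` with `|x| ≥ l`. -/
theorem avoidsRPowersEventually_decidable :
    ∃ f : ℕ × List (List ℕ) × ℕ × List ℕ × ℕ × ℕ → Bool,
      Computable f ∧
      ∀ (k : ℕ) (trans : List (List ℕ)) (q0 : ℕ) (out : List ℕ) (a : ℕ → ℕ)
        (p q : ℕ),
        2 ≤ k → dfaoGenerates k trans q0 out a → 1 ≤ q → q < p →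
        (f (k, trans, q0, out, p, q) = true ↔
          ∃ l : ℕ, ∀ (w : List ℕ) (T : ℕ), IsFactorOf a w → l ≤ T →
            ¬ IsRPowerOf p q T w) := by
  obtain ⟨_, hprim⟩ := DFAOInput.primrecPred_hasLongRPower.not
  refine ⟨_, hprim.to_comp, fun k trans q0 out a p q hk hgen hq hpq => ?_⟩
  rw [decide_eq_true_iff]
  beta_reduce
  rw [DFAOInput.hasLongRPower_iff hk hgen hq]
  push Not
  constructor
  · rintro ⟨l, hl⟩
    refine ⟨l + 1, fun w T hw hT hpow => ?_⟩
    obtain ⟨i, hi⟩ := (exists_isRPowerOf_iff hq hpq (by lia)).1 ⟨w, hw, hpow⟩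
    exact hl T i (by lia) hi
  · rintro ⟨l, hl⟩
    refine ⟨l + 1, fun T i hT hi => ?_⟩
    obtain ⟨w, hw, hpow⟩ := (exists_isRPowerOf_iff hq hpq (by lia)).2 ⟨i, hi⟩
    exact hl w T hw (by lia) hpow
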